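/- For any a ∈ [0,1] and b ∈ (0,1) with |b − 1/2| ≤ 1/4, the Kullback–Leibler divergence between the Bernoulli distributions with parameters a and b satisfies KL(Bern(a) ‖ Bern(b)) ≤ 8(a − b)². -/

import Mathlib

/-- The Kullback–Leibler divergence `KL(Bern(a) ‖ Bern(b))` between two Bernoulli
distributions, written via its explicit formula
`a·log(a/b) + (1−a)·log((1−a)/(1−b))`; the convention `0·log 0 = 0` is automatic since
multiplication by zero annihilates (and `Real.log 0 = 0`). -/
noncomputable def klBern (a b : ℝ) : ℝ :=
  a * Real.log (a / b) + (1 - a) * Real.log ((1 - a) / (1 - b))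

/-- The bound `log t ≤ t - 1`, scaled by a factor that is allowed to vanish. -/
theorem mul_log_div_le {x y : ℝ} (hx : 0 ≤ x) (hy : 0 < y) :
    x * Real.log (x / y) ≤ x * (x / y - 1) := by
  rcases hx.eq_or_lt with rfl | hx
  · simp
  · exact mul_le_mul_of_nonneg_left (Real.log_le_sub_one_of_pos (div_pos hx hy)) hx.le

/-- The Kullback–Leibler divergence is at most the chi-squared divergence. -/
theorem klBern_le_chiSq {a b : ℝ} (ha : a ∈ Set.Icc (0 : ℝ) 1) (hb : b ∈ Set.Ioo (0 : ℝ) 1) :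
    klBern a b ≤ (a - b) ^ 2 / (b * (1 - b)) := by
  have hb0 : b ≠ 0 := hb.1.ne'
  have hb1 : 1 - b ≠ 0 := (sub_pos.2 hb.2).ne'
  calc klBern a b ≤ a * (a / b - 1) + (1 - a) * ((1 - a) / (1 - b) - 1) :=
        add_le_add (mul_log_div_le ha.1 hb.1)
          (mul_log_div_le (sub_nonneg.2 ha.2) (sub_pos.2 hb.2))
    _ = (a - b) ^ 2 / (b * (1 - b)) := by
        field_simp
        ring

/-- For any `a ∈ [0,1]` and `b ∈ (0,1)` with `|b − 1/2| ≤ 1/4`,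
`KL(Bern(a) ‖ Bern(b)) ≤ 8(a − b)²`. -/
theorem klBern_le_eight_sq (a b : ℝ) (ha : a ∈ Set.Icc (0:ℝ) 1) (hb : b ∈ Set.Ioo (0:ℝ) 1)
    (hb2 : |b - 1/2| ≤ 1/4) :
    klBern a b ≤ 8 * (a - b) ^ 2 := by
  refine (klBern_le_chiSq ha hb).trans ?_
  obtain ⟨h1, h2⟩ := abs_le.1 hb2
  have hv : 1 / 8 ≤ b * (1 - b) := by nlinarith
  rw [div_le_iff₀ (by linarith)]
  nlinarith [mul_le_mul_of_nonneg_left hv (sq_nonneg (a - b))]
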